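/- (Extended Carleman inequality) Let α ≥ -1 and let k be a positive integer with k ≥ 2. Then for every f holomorphic on 𝔻, ‖f‖_{A^{2k}_{k(α+2)−2}} ≤ ‖f‖_{A²_α}. -/

import Mathlib

open MeasureTheory Set Filter
open scoped ENNReal NNReal Topology

noncomputable section

/-- The open unit disk in `ℂ`. -/
def unitDisk : Set ℂ := Metric.ball 0 1

/-- `c_β(n) = Γ(n+β)/(Γ(β)·n!)`. -/
def ccoef (β : ℝ) (n : ℕ) : ℝ := Real.Gamma (n + β) / (Real.Gamma β * n.factorial)

/-- The `n`-th Taylor coefficient of `f` at the origin. -/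
def taylorCoeff (f : ℂ → ℂ) (n : ℕ) : ℂ := iteratedDeriv n f 0 / n.factorial

/-- The square of the `A²_α` norm, `∑ |a_n|²/c_{α+2}(n)`, valued in `[0,∞]`. -/
def A2normSq (α : ℝ) (f : ℂ → ℂ) : ℝ≥0∞ :=
  ∑' n : ℕ, ENNReal.ofReal (‖taylorCoeff f n‖ ^ 2 / ccoef (α + 2) n)

/-- The `A²_α` norm (Hardy `H²` norm when `α = -1`). -/
def A2norm (α : ℝ) (f : ℂ → ℂ) : ℝ≥0∞ := A2normSq α f ^ (1 / 2 : ℝ)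

/-- The `p`-th power of the weighted Bergman norm `‖f‖_{A^p_β}`, valued in `[0,∞]`:
`(β+1) ∫_𝔻 (1-|z|²)^β |f z|^p dA(z)` with `dA` the normalized area measure. -/
def ApIntPow (p β : ℝ) (f : ℂ → ℂ) : ℝ≥0∞ :=
  ENNReal.ofReal (β + 1) *
    (∫⁻ z in unitDisk, ENNReal.ofReal ((1 - ‖z‖ ^ 2) ^ β * ‖f z‖ ^ p)) / ENNReal.ofReal Real.pi

/-- The weighted Bergman norm `‖f‖_{A^p_β}`, valued in `[0,∞]`. -/
def ApNorm (p β : ℝ) (f : ℂ → ℂ) : ℝ≥0∞ := ApIntPow p β f ^ (1 / p)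

/-- The inner integral `∫₀¹ s^{α+1}/(1-(1-|z|²)s) ds`, valued in `[0,∞]`. -/
def Hinner (α : ℝ) (z : ℂ) : ℝ≥0∞ :=
  ∫⁻ s in Set.Ioo (0 : ℝ) 1, ENNReal.ofReal (s ^ (α + 1) / (1 - (1 - ‖z‖ ^ 2) * s))

/-- The quantity `F_p(f)`. -/
def Ffun (α p : ℝ) (f : ℂ → ℂ) : ℝ≥0∞ :=
  ENNReal.ofReal (‖f 0‖ ^ p) +
    ENNReal.ofReal (p / 2) *
      (∫⁻ z in unitDisk,
        ENNReal.ofReal (‖deriv f z‖ ^ 2 * ‖f z‖ ^ (p - 2) * (1 - ‖z‖ ^ 2) ^ (p * (α + 2) / 2)) *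
          Hinner α z) / ENNReal.ofReal Real.pi

/-- The quantity `G_p(f)`. -/
def Gfun (α p : ℝ) (f : ℂ → ℂ) : ℝ≥0∞ :=
  ENNReal.ofReal (p / (2 * (α + 2))) *
    (∫⁻ z in unitDisk,
      ENNReal.ofReal (‖deriv f z‖ ^ 2 * ‖f z‖ ^ (p - 2) * (1 - ‖z‖ ^ 2) ^ (p * (α + 2) / 2))) /
    ENNReal.ofReal Real.pi

open Finset.HasAntidiagonal (antidiagonal mem_antidiagonal)

lemma ccoef_pos {β : ℝ} (hβ : 0 < β) (n : ℕ) : 0 < ccoef β n := by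
  unfold ccoef
  have := Real.Gamma_pos_of_pos hβ
  have := Real.Gamma_pos_of_pos (show 0 < n + β by positivity)
  positivity

lemma ccoef_zero {β : ℝ} (hβ : 0 < β) : ccoef β 0 = 1 := by
  have := (Real.Gamma_pos_of_pos hβ).ne'
  simp [ccoef, this]

lemma ccoef_succ {β : ℝ} (hβ : 0 < β) (n : ℕ) :
    (n + 1) * ccoef β (n + 1) = (n + β) * ccoef β n := by
  have h : ((n + 1 : ℕ) : ℝ) + β = (n + β) + 1 := by push_cast; ring
  have h0 := (Real.Gamma_pos_of_pos hβ).ne'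
  rw [ccoef, ccoef, h, Real.Gamma_add_one (by positivity), Nat.factorial_succ]
  push_cast
  field_simp

/-- The Chu–Vandermonde identity for the coefficients `c_β(n)`. -/
lemma sum_antidiagonal_ccoef_mul {β γ : ℝ} (hβ : 0 < β) (hγ : 0 < γ) (n : ℕ) :
    ∑ ij ∈ antidiagonal n, ccoef β ij.1 * ccoef γ ij.2 = ccoef (β + γ) n := by
  induction n with
  | zero => simp [ccoef_zero, hβ, hγ, add_pos]
  | succ n ih =>
    have hn : (n + 1 : ℝ) ≠ 0 := by positivity
    refine mul_left_cancel₀ hn ?_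
    rw [ccoef_succ (add_pos hβ hγ), ← ih, Finset.mul_sum, Finset.mul_sum]
    have split : ∑ ij ∈ antidiagonal (n + 1), (n + 1 : ℝ) * (ccoef β ij.1 * ccoef γ ij.2) =
        ∑ ij ∈ antidiagonal (n + 1), (ij.1 * ccoef β ij.1) * ccoef γ ij.2 +
        ∑ ij ∈ antidiagonal (n + 1), ccoef β ij.1 * (ij.2 * ccoef γ ij.2) := by
      rw [← Finset.sum_add_distrib]
      refine Finset.sum_congr rfl fun ij hij ↦ ?_
      have : (ij.1 + ij.2 : ℝ) = n + 1 := by exact_mod_cast mem_antidiagonal.1 hij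
      rw [← this]
      ring
    rw [split, Finset.Nat.sum_antidiagonal_succ, Finset.Nat.sum_antidiagonal_succ']
    simp only [Nat.cast_zero, zero_mul, mul_zero, zero_add, Nat.cast_add, Nat.cast_one,
      ccoef_succ hβ, ccoef_succ hγ]
    rw [← Finset.sum_add_distrib]
    refine Finset.sum_congr rfl fun ij hij ↦ ?_
    have : (ij.1 + ij.2 : ℝ) = n := by exact_mod_cast mem_antidiagonal.1 hij
    rw [← this]
    ring

/-- The squared norm `∑ |a_n|²/c_β(n)` of a coefficient sequence. -/
def coeffNormSq (β : ℝ) (a : ℕ → ℂ) : ℝ≥0∞ := ∑' n, ENNReal.ofReal (‖a n‖ ^ 2 / ccoef β n)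

/-- The Cauchy product of two coefficient sequences. -/
def cauchyProd (a b : ℕ → ℂ) (n : ℕ) : ℂ := ∑ ij ∈ antidiagonal n, a ij.1 * b ij.2

lemma norm_cauchyProd_sq_div_ccoef_le {β γ : ℝ} (hβ : 0 < β) (hγ : 0 < γ) (a b : ℕ → ℂ) (n : ℕ) :
    ‖cauchyProd a b n‖ ^ 2 / ccoef (β + γ) n ≤ ∑ ij ∈ antidiagonal n,
      (‖a ij.1‖ ^ 2 / ccoef β ij.1) * (‖b ij.2‖ ^ 2 / ccoef γ ij.2) := by
  have hpos := ccoef_pos (add_pos hβ hγ) n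
  calc ‖cauchyProd a b n‖ ^ 2 / ccoef (β + γ) n
      ≤ (∑ ij ∈ antidiagonal n, ‖a ij.1‖ * ‖b ij.2‖) ^ 2 / ccoef (β + γ) n := by
        gcongr
        exact (norm_sum_le _ _).trans_eq (Finset.sum_congr rfl fun _ _ ↦ norm_mul _ _)
    _ = (∑ ij ∈ antidiagonal n, ‖a ij.1‖ * ‖b ij.2‖) ^ 2 /
          ∑ ij ∈ antidiagonal n, ccoef β ij.1 * ccoef γ ij.2 := by
        rw [sum_antidiagonal_ccoef_mul hβ hγ]
    _ ≤ ∑ ij ∈ antidiagonal n,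
          (‖a ij.1‖ * ‖b ij.2‖) ^ 2 / (ccoef β ij.1 * ccoef γ ij.2) :=
        Finset.sq_sum_div_le_sum_sq_div _ _ fun _ _ ↦ mul_pos (ccoef_pos hβ _) (ccoef_pos hγ _)
    _ = _ := Finset.sum_congr rfl fun _ _ ↦ by rw [mul_pow, mul_div_mul_comm]

/-- The Cauchy product formula in `ℝ≥0∞`. -/
lemma ennreal_tsum_mul_tsum_eq_tsum_sum_antidiagonal (u v : ℕ → ℝ≥0∞) :
    (∑' n, u n) * ∑' n, v n =
      ∑' n, ∑ ij ∈ antidiagonal n, u ij.1 * v ij.2 := by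
  have hsub (n : ℕ) : ∑ ij ∈ antidiagonal n, u ij.1 * v ij.2 =
      ∑' ij : antidiagonal n, u ij.1.1 * v ij.1.2 :=
    (Finset.tsum_subtype _ fun ij : ℕ × ℕ ↦ u ij.1 * v ij.2).symm
  simp_rw [hsub]
  rw [← ENNReal.tsum_sigma' fun p : (n : ℕ) × antidiagonal n ↦
    u p.2.1.1 * v p.2.1.2]
  refine Eq.symm ((Finset.HasAntidiagonal.sigmaAntidiagonalEquivProd.tsum_eq
    fun p : ℕ × ℕ ↦ u p.1 * v p.2).trans ?_)
  rw [ENNReal.tsum_prod']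
  simp_rw [ENNReal.tsum_mul_left, ENNReal.tsum_mul_right]

lemma coeffNormSq_cauchyProd_le {β γ : ℝ} (hβ : 0 < β) (hγ : 0 < γ) (a b : ℕ → ℂ) :
    coeffNormSq (β + γ) (cauchyProd a b) ≤ coeffNormSq β a * coeffNormSq γ b := by
  have hnn (β : ℝ) (hβ : 0 < β) (a : ℕ → ℂ) (n : ℕ) : 0 ≤ ‖a n‖ ^ 2 / ccoef β n :=
    div_nonneg (sq_nonneg _) (ccoef_pos hβ n).le
  rw [coeffNormSq, coeffNormSq, coeffNormSq,
    ennreal_tsum_mul_tsum_eq_tsum_sum_antidiagonal]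
  refine ENNReal.tsum_le_tsum fun n ↦ ?_
  simp_rw [← ENNReal.ofReal_mul (hnn β hβ a _)]
  rw [← ENNReal.ofReal_sum_of_nonneg fun _ _ ↦ mul_nonneg (hnn β hβ a _) (hnn γ hγ b _)]
  exact ENNReal.ofReal_le_ofReal (norm_cauchyProd_sq_div_ccoef_le hβ hγ a b n)

/-- `a` is the sequence of coefficients of a power series converging to `g` on the unit disk. -/
def IsPowerSeriesOnDisk (a : ℕ → ℂ) (g : ℂ → ℂ) : Prop :=
  ∀ z ∈ unitDisk, HasSum (fun n ↦ a n * z ^ n) (g z)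

lemma IsPowerSeriesOnDisk.mul {a b : ℕ → ℂ} {g h : ℂ → ℂ} (ha : IsPowerSeriesOnDisk a g)
    (hb : IsPowerSeriesOnDisk b h) : IsPowerSeriesOnDisk (cauchyProd a b) (g * h) := by
  intro z hz
  have hsa := (ha z hz).summable.norm
  have hsb := (hb z hz).summable.norm
  have hs := (summable_norm_sum_mul_antidiagonal_of_summable_norm hsa hsb).of_norm.hasSum
  rw [← tsum_mul_tsum_eq_tsum_sum_antidiagonal_of_summable_norm hsa hsb, (ha z hz).tsum_eq,
    (hb z hz).tsum_eq] at hs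
  refine hs.congr_fun fun n ↦ ?_
  rw [cauchyProd, Finset.sum_mul]
  refine Finset.sum_congr rfl fun ij hij ↦ ?_
  rw [← mem_antidiagonal.1 hij, pow_add]
  ring

lemma isPowerSeriesOnDisk_taylorCoeff {f : ℂ → ℂ} (hf : DifferentiableOn ℂ f unitDisk) :
    IsPowerSeriesOnDisk (taylorCoeff f) f := by
  intro z hz
  refine (Complex.hasSum_taylorSeries_on_ball hf hz).congr_fun fun n ↦ ?_
  simp only [taylorCoeff, smul_eq_mul, sub_zero]
  field_simp

lemma IsPowerSeriesOnDisk.exists_pow {β : ℝ} (hβ : 0 < β) {a : ℕ → ℂ} {g : ℂ → ℂ}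
    (ha : IsPowerSeriesOnDisk a g) {k : ℕ} (hk : 1 ≤ k) :
    ∃ b, IsPowerSeriesOnDisk b (g ^ k) ∧ coeffNormSq (k * β) b ≤ coeffNormSq β a ^ k := by
  induction k, hk using Nat.le_induction with
  | base => exact ⟨a, by simpa using ha, by simp⟩
  | succ k hk ih =>
    obtain ⟨b, hb, hle⟩ := ih
    refine ⟨cauchyProd b a, by simpa [pow_succ] using hb.mul ha, ?_⟩
    have hkβ : 0 < (k : ℝ) * β := mul_pos (by exact_mod_cast hk) hβ
    rw [Nat.cast_add_one, add_one_mul, pow_succ]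
    exact (coeffNormSq_cauchyProd_le hkβ hβ b a).trans (by gcongr)

lemma integral_exp_pow_succ_eq_zero (n : ℕ) :
    ∫ θ in (-Real.pi)..Real.pi, Complex.exp (θ * Complex.I) ^ (n + 1) = 0 := by
  have hc : ((n + 1 : ℕ) : ℂ) * Complex.I ≠ 0 :=
    mul_ne_zero (Nat.cast_ne_zero.2 n.succ_ne_zero) Complex.I_ne_zero
  have h : ∀ θ : ℝ, Complex.exp (θ * Complex.I) ^ (n + 1) =
      Complex.exp (((n + 1 : ℕ) : ℂ) * Complex.I * θ) := fun θ ↦ by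
    rw [← Complex.exp_nat_mul]
    congr 1
    ring
  simp_rw [h]
  rw [integral_exp_mul_complex hc, div_eq_zero_iff, sub_eq_zero]
  left
  rw [Complex.exp_eq_exp_iff_exists_int]
  exact ⟨n + 1, by push_cast; ring⟩

/-- Parseval's identity for polynomials on the unit circle. -/
lemma integral_norm_sum_exp_pow_sq (N : ℕ) (a : ℕ → ℂ) :
    ∫ θ in (-Real.pi)..Real.pi,
      ‖∑ n ∈ Finset.range N, a n * Complex.exp (θ * Complex.I) ^ n‖ ^ 2 =
        2 * Real.pi * ∑ n ∈ Finset.range N, ‖a n‖ ^ 2 := by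
  induction N generalizing a with
  | zero => simp
  | succ N ih =>
    have hexp (θ : ℝ) : ‖∑ n ∈ Finset.range (N + 1), a n * Complex.exp (θ * Complex.I) ^ n‖ ^ 2 =
        ‖∑ n ∈ Finset.range N, a (n + 1) * Complex.exp (θ * Complex.I) ^ n‖ ^ 2 + ‖a 0‖ ^ 2 +
        (2 * starRingEnd ℂ (a 0) *
          ∑ n ∈ Finset.range N, a (n + 1) * Complex.exp (θ * Complex.I) ^ (n + 1)).re := by
      have hfac : ∑ n ∈ Finset.range N, a (n + 1) * Complex.exp (θ * Complex.I) ^ (n + 1) =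
          Complex.exp (θ * Complex.I) *
            ∑ n ∈ Finset.range N, a (n + 1) * Complex.exp (θ * Complex.I) ^ n := by
        rw [Finset.mul_sum]
        exact Finset.sum_congr rfl fun n _ ↦ by ring
      rw [Finset.sum_range_succ', pow_zero, mul_one, Complex.sq_norm, Complex.normSq_add,
        ← Complex.sq_norm, ← Complex.sq_norm]
      congr 1
      · rw [hfac, norm_mul, Complex.norm_exp_ofReal_mul_I, one_mul]
      · rw [mul_comm _ (starRingEnd ℂ (a 0)), mul_assoc, ← Complex.ofReal_ofNat,
          Complex.re_ofReal_mul]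
    have hcross : ∫ θ in (-Real.pi)..Real.pi, (2 * starRingEnd ℂ (a 0) *
        ∑ n ∈ Finset.range N, a (n + 1) * Complex.exp (θ * Complex.I) ^ (n + 1)).re = 0 := by
      have hint : IntervalIntegrable (fun θ : ℝ ↦ 2 * starRingEnd ℂ (a 0) *
          ∑ n ∈ Finset.range N, a (n + 1) * Complex.exp (θ * Complex.I) ^ (n + 1))
          volume (-Real.pi) Real.pi := Continuous.intervalIntegrable (by fun_prop) _ _
      have := Complex.reCLM.intervalIntegral_comp_comm hint
      simp only [Complex.reCLM_apply] at this
      rw [this, intervalIntegral.integral_const_mul, intervalIntegral.integral_finsetSum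
        fun n _ ↦ Continuous.intervalIntegrable (by fun_prop) _ _]
      simp [integral_exp_pow_succ_eq_zero]
    simp_rw [hexp]
    rw [intervalIntegral.integral_add (Continuous.intervalIntegrable (by fun_prop) _ _)
      (Continuous.intervalIntegrable (by fun_prop) _ _), intervalIntegral.integral_add
      (Continuous.intervalIntegrable (by fun_prop) _ _)
      (Continuous.intervalIntegrable (by fun_prop) _ _), hcross, ih, Finset.sum_range_succ',
      intervalIntegral.integral_const]
    simp only [smul_eq_mul]
    ring

lemma lintegral_norm_sum_circle_sq (N : ℕ) (a : ℕ → ℂ) (r : ℝ) :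
    ∫⁻ θ in Ioo (-Real.pi) Real.pi, ENNReal.ofReal
      (‖∑ n ∈ Finset.range N, a n * (r * Complex.exp (θ * Complex.I)) ^ n‖ ^ 2) =
        ENNReal.ofReal (2 * Real.pi * ∑ n ∈ Finset.range N, ‖a n‖ ^ 2 * r ^ (2 * n)) := by
  have hle : -Real.pi ≤ Real.pi := by linarith [Real.pi_pos]
  have h := integral_norm_sum_exp_pow_sq N fun n ↦ a n * r ^ n
  simp only [norm_mul, norm_pow, Complex.norm_real, mul_pow, Real.norm_eq_abs, mul_assoc] at h
  simp only [mul_pow, mul_assoc, pow_mul]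
  rw [← ofReal_integral_eq_lintegral_ofReal, ← integral_Ioc_eq_integral_Ioo,
    ← intervalIntegral.integral_of_le hle, h]
  · simp only [pow_right_comm _ _ 2, sq_abs]
  · exact (Continuous.integrableOn_Icc (by fun_prop)).mono_set Ioo_subset_Icc_self
  · exact ae_of_all _ fun _ ↦ sq_nonneg _

lemma lintegral_Ioo_pow_mul_one_sub_rpow {B : ℝ} (hB : 1 < B) (n : ℕ) :
    ∫⁻ t in Ioo (0 : ℝ) 1, ENNReal.ofReal (t ^ n * (1 - t) ^ (B - 2)) =
      ENNReal.ofReal (1 / ((B - 1) * ccoef B n)) := by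
  have hn : (0 : ℝ) < n + 1 := by positivity
  have hB' : 0 < B - 1 := by linarith
  have hone := ProbabilityTheory.lintegral_betaPDF_eq_one hn hB'
  have hbeta := ProbabilityTheory.beta_pos hn hB'
  have hval : 1 / ((B - 1) * ccoef B n) = ProbabilityTheory.beta (n + 1) (B - 1) := by
    have h1 : Real.Gamma B = (B - 1) * Real.Gamma (B - 1) := by
      rw [← Real.Gamma_add_one hB'.ne', sub_add_cancel]
    have h2 : (n + 1 : ℝ) + (B - 1) = n + B := by ring
    have h3 := (Real.Gamma_pos_of_pos hB').ne'
    have h4 := (Real.Gamma_pos_of_pos (show 0 < n + B by positivity)).ne'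
    rw [ccoef, ProbabilityTheory.beta, h1, h2, Real.Gamma_nat_eq_factorial]
    field_simp
  rw [ProbabilityTheory.lintegral_betaPDF] at hone
  have hmul (t : ℝ) : ENNReal.ofReal (t ^ n * (1 - t) ^ (B - 2)) =
      ENNReal.ofReal (ProbabilityTheory.beta (n + 1) (B - 1)) * ENNReal.ofReal
        (1 / ProbabilityTheory.beta (n + 1) (B - 1) * t ^ ((n + 1 : ℝ) - 1) *
          (1 - t) ^ (B - 1 - 1)) := by
    rw [← ENNReal.ofReal_mul hbeta.le, add_sub_cancel_right, Real.rpow_natCast,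
      show B - 1 - 1 = B - 2 by ring]
    congr 1
    field_simp
  simp_rw [hmul]
  rw [lintegral_const_mul _ (by fun_prop), hone, mul_one, hval]

lemma lintegral_Ioo_two_mul_comp_sq (F : ℝ → ℝ≥0∞) :
    ∫⁻ r in Ioo (0 : ℝ) 1, ENNReal.ofReal (2 * r) * F (r ^ 2) = ∫⁻ t in Ioo (0 : ℝ) 1, F t := by
  have himg : (fun r : ℝ ↦ r ^ 2) '' Ioo 0 1 = Ioo 0 1 := by
    ext t
    constructor
    · rintro ⟨r, hr, rfl⟩
      exact ⟨pow_pos hr.1 2, pow_lt_one₀ hr.1.le hr.2 two_ne_zero⟩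
    · intro ht
      exact ⟨√t, ⟨Real.sqrt_pos.2 ht.1, (Real.sqrt_lt' one_pos).2 (by simpa using ht.2)⟩,
        Real.sq_sqrt ht.1.le⟩
  have hinj : InjOn (fun r : ℝ ↦ r ^ 2) (Ioo 0 1) := fun x hx y hy h ↦
    (pow_left_inj₀ hx.1.le hy.1.le two_ne_zero).1 h
  conv_rhs => rw [← himg, lintegral_image_eq_lintegral_abs_deriv_mul measurableSet_Ioo
    (fun x _ ↦ (hasDerivAt_pow 2 x).hasDerivWithinAt) hinj]
  refine setLIntegral_congr_fun measurableSet_Ioo fun r hr ↦ ?_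
  simp [abs_of_pos hr.1]

lemma lintegral_unitDisk_eq {F : ℂ → ℝ≥0∞} (hF : Measurable F) :
    ∫⁻ z in unitDisk, F z = ∫⁻ r in Ioo (0 : ℝ) 1, ENNReal.ofReal r *
      ∫⁻ θ in Ioo (-Real.pi) Real.pi, F (r * Complex.exp (θ * Complex.I)) := by
  have hsymm (p : ℝ × ℝ) : Complex.polarCoord.symm p = p.1 * Complex.exp (p.2 * Complex.I) := by
    rw [Complex.polarCoord_symm_apply, Complex.exp_mul_I]
    push_cast
    rfl
  have hdisk : MeasurableSet unitDisk := measurableSet_ball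
  have hG : Measurable (unitDisk.indicator F) := hF.indicator hdisk
  have hmeas : Measurable fun p : ℝ × ℝ ↦ ENNReal.ofReal p.1 *
      unitDisk.indicator F (p.1 * Complex.exp (p.2 * Complex.I)) :=
    Measurable.mul (by fun_prop) (hG.comp (by fun_prop))
  rw [← lintegral_indicator hdisk, ← Complex.lintegral_comp_polarCoord_symm]
  simp only [hsymm, smul_eq_mul, polarCoord_target]
  rw [Measure.volume_eq_prod, ← Measure.prod_restrict, lintegral_prod _ hmeas.aemeasurable]
  have hIoo : Ioi (0 : ℝ) ∩ Iio 1 = Ioo 0 1 := rfl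
  rw [← hIoo, inter_comm, ← Measure.restrict_restrict measurableSet_Iio,
    ← lintegral_indicator measurableSet_Iio]
  refine setLIntegral_congr_fun measurableSet_Ioi fun r (hr : 0 < r) ↦ ?_
  dsimp only
  have hcircle : Measurable fun θ : ℝ ↦ unitDisk.indicator F (r * Complex.exp (θ * Complex.I)) :=
    hG.comp (by fun_prop)
  rw [lintegral_const_mul _ hcircle]
  have hmem (θ : ℝ) : (r * Complex.exp (θ * Complex.I) : ℂ) ∈ unitDisk ↔ r < 1 := by
    simp [unitDisk, Complex.norm_exp_ofReal_mul_I, abs_of_pos hr]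
  by_cases h1 : r < 1
  · simp [indicator_of_mem ((hmem _).2 h1), h1]
  · simp [indicator_of_notMem (fun h ↦ h1 ((hmem _).1 h)), h1]

/-- The weighted Bergman norm of a polynomial in terms of its coefficients. -/
lemma lintegral_unitDisk_weight_mul_norm_sum_sq {B : ℝ} (hB : 1 < B) (N : ℕ) (a : ℕ → ℂ) :
    ENNReal.ofReal (B - 1) * (∫⁻ z in unitDisk, ENNReal.ofReal
      ((1 - ‖z‖ ^ 2) ^ (B - 2) * ‖∑ n ∈ Finset.range N, a n * z ^ n‖ ^ 2)) /
        ENNReal.ofReal Real.pi =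
      ∑ n ∈ Finset.range N, ENNReal.ofReal (‖a n‖ ^ 2 / ccoef B n) := by
  have hinner : ∀ r ∈ Ioo (0 : ℝ) 1, ENNReal.ofReal r *
      ∫⁻ θ in Ioo (-Real.pi) Real.pi, ENNReal.ofReal
        ((1 - ‖(r * Complex.exp (θ * Complex.I) : ℂ)‖ ^ 2) ^ (B - 2) *
          ‖∑ n ∈ Finset.range N, a n * (r * Complex.exp (θ * Complex.I)) ^ n‖ ^ 2) =
      ENNReal.ofReal (2 * r) * ∑ n ∈ Finset.range N, ENNReal.ofReal (Real.pi * ‖a n‖ ^ 2) *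
        ENNReal.ofReal ((r ^ 2) ^ n * (1 - r ^ 2) ^ (B - 2)) := by
    intro r hr
    have hw : 0 ≤ (1 - r ^ 2) ^ (B - 2) :=
      Real.rpow_nonneg (by nlinarith [hr.1, hr.2]) _
    simp only [norm_mul, Complex.norm_real, Complex.norm_exp_ofReal_mul_I, mul_one,
      Real.norm_eq_abs, sq_abs, ENNReal.ofReal_mul hw]
    rw [lintegral_const_mul _ (by fun_prop), lintegral_norm_sum_circle_sq]
    have hπ := Real.pi_pos
    have hr0 := hr.1
    simp_rw [← ENNReal.ofReal_mul (show 0 ≤ Real.pi * ‖a _‖ ^ 2 by positivity)]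
    rw [← ENNReal.ofReal_sum_of_nonneg fun n _ ↦ by positivity, ← ENNReal.ofReal_mul hw,
      ← ENNReal.ofReal_mul hr0.le, ← ENNReal.ofReal_mul (by positivity)]
    congr 1
    simp only [Finset.mul_sum]
    exact Finset.sum_congr rfl fun n _ ↦ by ring
  rw [lintegral_unitDisk_eq (by fun_prop), setLIntegral_congr_fun measurableSet_Ioo hinner,
    lintegral_Ioo_two_mul_comp_sq fun t ↦ ∑ n ∈ Finset.range N,
      ENNReal.ofReal (Real.pi * ‖a n‖ ^ 2) * ENNReal.ofReal (t ^ n * (1 - t) ^ (B - 2)),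
    lintegral_finsetSum _ fun n _ ↦ by fun_prop, Finset.mul_sum, ENNReal.div_eq_inv_mul,
    Finset.mul_sum]
  refine Finset.sum_congr rfl fun n _ ↦ ?_
  have hc := ccoef_pos (show 0 < B by linarith) n
  have hB' : 0 < B - 1 := by linarith
  rw [lintegral_const_mul _ (by fun_prop), lintegral_Ioo_pow_mul_one_sub_rpow hB,
    ← ENNReal.ofReal_inv_of_pos Real.pi_pos, ← ENNReal.ofReal_mul (by positivity),
    ← ENNReal.ofReal_mul hB'.le, ← ENNReal.ofReal_mul (by positivity)]
  congr 1
  field_simp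

lemma IsPowerSeriesOnDisk.lintegral_le_coeffNormSq {B : ℝ} (hB : 1 < B) {a : ℕ → ℂ} {g : ℂ → ℂ}
    (ha : IsPowerSeriesOnDisk a g) :
    ENNReal.ofReal (B - 1) * (∫⁻ z in unitDisk, ENNReal.ofReal
      ((1 - ‖z‖ ^ 2) ^ (B - 2) * ‖g z‖ ^ 2)) / ENNReal.ofReal Real.pi ≤ coeffNormSq B a := by
  have hB0 : ENNReal.ofReal (B - 1) ≠ 0 := by simpa using hB
  have hπ0 : ENNReal.ofReal Real.pi ≠ 0 := by simpa using Real.pi_pos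
  rw [ENNReal.div_le_iff hπ0 ENNReal.ofReal_ne_top, mul_comm,
    ← ENNReal.le_div_iff_mul_le (.inl hB0) (.inl ENNReal.ofReal_ne_top)]
  have hfatou : ∫⁻ z in unitDisk, ENNReal.ofReal ((1 - ‖z‖ ^ 2) ^ (B - 2) * ‖g z‖ ^ 2) =
      ∫⁻ z in unitDisk, liminf (fun N ↦ ENNReal.ofReal
        ((1 - ‖z‖ ^ 2) ^ (B - 2) * ‖∑ n ∈ Finset.range N, a n * z ^ n‖ ^ 2)) atTop := by
    refine setLIntegral_congr_fun measurableSet_ball fun z hz ↦ ?_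
    have ht := (ha z hz).tendsto_sum_nat
    exact (ENNReal.tendsto_ofReal ((ht.norm.pow 2).const_mul _)).liminf_eq.symm
  rw [hfatou]
  refine (lintegral_liminf_le fun N ↦ by fun_prop).trans ?_
  refine liminf_le_of_le (by isBoundedDefault) fun x hx ↦ ?_
  obtain ⟨N, hN⟩ := hx.exists
  refine hN.trans ?_
  rw [ENNReal.le_div_iff_mul_le (.inl hB0) (.inl ENNReal.ofReal_ne_top), mul_comm,
    ← ENNReal.div_le_iff hπ0 ENNReal.ofReal_ne_top, lintegral_unitDisk_weight_mul_norm_sum_sq hB]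
  exact ENNReal.sum_le_tsum _

/-- Extended Carleman inequality: for α ≥ -1 and an integer k ≥ 2,
‖f‖_{A^{2k}_{k(α+2)-2}} ≤ ‖f‖_{A²_α} for every f holomorphic on 𝔻. -/
theorem statement3 (α : ℝ) (k : ℕ) (hα : -1 ≤ α) (hk : 2 ≤ k) (f : ℂ → ℂ)
    (hf : DifferentiableOn ℂ f unitDisk) :
    ApNorm (2 * k) (k * (α + 2) - 2) f ≤ A2norm α f := by
  have hk' : (2 : ℝ) ≤ k := by exact_mod_cast hk
  have hB : 1 < k * (α + 2) := by nlinarith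
  obtain ⟨b, hb, hle⟩ := (isPowerSeriesOnDisk_taylorCoeff hf).exists_pow
    (show 0 < α + 2 by linarith) (show 1 ≤ k by lia)
  have hpow : ApIntPow (2 * k) (k * (α + 2) - 2) f ≤ A2normSq α f ^ k := by
    refine le_trans (le_of_eq ?_) ((hb.lintegral_le_coeffNormSq hB).trans hle)
    have hnorm (z : ℂ) : ‖f z‖ ^ (2 * k : ℝ) = ‖(f ^ k) z‖ ^ 2 := by
      rw [Pi.pow_apply, norm_pow, ← pow_mul, mul_comm k 2, ← Real.rpow_natCast]
      push_cast
      rfl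
    simp only [ApIntPow, hnorm]
    rw [show (k : ℝ) * (α + 2) - 2 + 1 = k * (α + 2) - 1 by ring]
  calc ApNorm (2 * k) (k * (α + 2) - 2) f
      ≤ (A2normSq α f ^ k) ^ (1 / (2 * k) : ℝ) := by
        unfold ApNorm
        gcongr
    _ = A2norm α f := by
        rw [A2norm, ← ENNReal.rpow_natCast, ← ENNReal.rpow_mul]
        congr 1
        field_simp

end
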